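/- If Im ρ_{xy} ≥ 0 for all x,y ∈ V (an RC-network, i.e. all edge impedances z_{xy} = 1/ρ_{xy} have Im z_{xy} ≤ 0), then any solution v of the Dirichlet problem satisfies Im 𝒫_eff ≥ 0; if instead Im ρ_{xy} ≤ 0 for all x,y ∈ V (an RL-network), then Im 𝒫_eff ≤ 0. -/

import Mathlib

open Finset

/-- Discrete Green formula for the network Laplacian with symmetric weights. -/
lemma two_mul_sum_mul_laplacian {V : Type*} [Fintype V] (ρ : V → V → ℂ)
    (hsym : ∀ x y, ρ x y = ρ y x) (f g : V → ℂ) :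
    2 * ∑ x, g x * ∑ y, (f y - f x) * ρ x y =
      ∑ x, ∑ y, (g x - g y) * (f y - f x) * ρ x y := by
  have hswap : ∑ x, ∑ y, g x * ((f y - f x) * ρ x y) =
      ∑ x, ∑ y, g y * ((f x - f y) * ρ x y) := by
    rw [Finset.sum_comm]
    simp only [fun x y => hsym y x]
  rw [two_mul]
  simp only [Finset.mul_sum]
  nth_rewrite 2 [hswap]
  simp only [← Finset.sum_add_distrib]
  refine Finset.sum_congr rfl fun x _ => Finset.sum_congr rfl fun y _ => ?_
  ring

/-- The effective admittance is half the total energy of a solution of the Dirichlet problem. -/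
lemma two_mul_admittance_eq_energy {V : Type*} [Fintype V] (ρ : V → V → ℂ)
    (hsym : ∀ x y, ρ x y = ρ y x) (a₀ a₁ : V) (v : V → ℂ)
    (hv : ∀ x, x ≠ a₀ → x ≠ a₁ → ∑ y, (v y - v x) * ρ x y = 0)
    (hv0 : v a₀ = 0) (hv1 : v a₁ = 1) :
    2 * ∑ x, v x * ρ x a₀ = ∑ x, ∑ y, (Complex.normSq (v y - v x) : ℂ) * ρ x y := by
  have hgreen := two_mul_sum_mul_laplacian ρ hsym v fun x => 1 - (starRingEnd ℂ) (v x)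
  rw [Finset.sum_eq_single_of_mem a₀ (Finset.mem_univ _)] at hgreen
  · simp only [hv0, map_zero, sub_zero, one_mul] at hgreen
    rw [Finset.sum_congr rfl fun x _ => by rw [hsym x a₀], hgreen]
    refine Finset.sum_congr rfl fun x _ => Finset.sum_congr rfl fun y _ => ?_
    rw [Complex.normSq_eq_conj_mul_self, map_sub]
    ring
  · intro x _ hx
    by_cases hx1 : x = a₁
    · simp [hx1, hv1]
    · rw [hv x hx hx1, mul_zero]

/-- For an RC-network (`Im ρ_{xy} ≥ 0` for all edges) the effective admittance
satisfies `Im 𝒫_eff ≥ 0`; for an RL-network (`Im ρ_{xy} ≤ 0`) one has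
`Im 𝒫_eff ≤ 0`. -/
theorem im_admittance_sign {V : Type*} [Fintype V]
    (ρ : V → V → ℂ) (hsym : ∀ x y, ρ x y = ρ y x) (hdiag : ∀ x, ρ x x = 0)
    (a₀ a₁ : V) (hne : a₀ ≠ a₁)
    (v : V → ℂ)
    (hv : ∀ x, x ≠ a₀ → x ≠ a₁ → ∑ y, (v y - v x) * ρ x y = 0)
    (hv0 : v a₀ = 0) (hv1 : v a₁ = 1) :
    ((∀ x y, 0 ≤ (ρ x y).im) → 0 ≤ (∑ x, v x * ρ x a₀).im) ∧
    ((∀ x y, (ρ x y).im ≤ 0) → (∑ x, v x * ρ x a₀).im ≤ 0) := by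
  have him := congrArg Complex.im (two_mul_admittance_eq_energy ρ hsym a₀ a₁ v hv hv0 hv1)
  rw [← Complex.ofReal_ofNat, Complex.im_ofReal_mul] at him
  simp only [Complex.im_sum, Complex.im_ofReal_mul] at him
  simp only [Complex.im_sum]
  refine ⟨fun h => ?_, fun h => ?_⟩
  · have := Finset.sum_nonneg fun x (_ : x ∈ univ) => Finset.sum_nonneg fun y (_ : y ∈ univ) =>
      mul_nonneg (Complex.normSq_nonneg (v y - v x)) (h x y)
    linarith
  · have := Finset.sum_nonpos fun x (_ : x ∈ univ) => Finset.sum_nonpos fun y (_ : y ∈ univ) =>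
      mul_nonpos_of_nonneg_of_nonpos (Complex.normSq_nonneg (v y - v x)) (h x y)
    linarith
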